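/- arXiv:2010.02320 — 7 statements merged into one kernel-verified Lean document; each statement's English description precedes it below -/
import Mathlib

section
/- Let (X_n, d_n)_{n ∈ ℕ} be metric spaces, ι_n : X_n → X_{n+1} maps with d_{n+1}(ι_n(x), ι_n(y)) ≤ d_n(x,y) for all x,y ∈ X_n, and T_n : X_n → X_{n+1} maps. Let (λ_n)_{n ≥ 1} be positive reals and assume: (1) ι_{n+1} ∘ T_n = T_{n+1} ∘ ι_n for all n; (2) d_{n+1}(T_n(x), T_n(y)) ≤ λ_{n+1} d_n(x,y) for all x,y ∈ X_n (with the convention that T_n is a contraction with factor λ_{n+1}); (3) λ_1 ≥ λ_2 ≥ λ_3 ≥ …; (4) λ_1 λ_2 ⋯ λ_n → 0 as n → ∞. Then for any x_0 ∈ X_0, the sequence defined by x_{n+1} = T_n(x_n) is Cauchy in the relative sense: for every ε > 0 there exists N such that for all m ≥ n ≥ N, d_m(ι_{mn}(x_n), x_m) < ε, where ι_{mn} = ι_{m−1} ∘ ⋯ ∘ ι_n denotes the composite restriction map X_n → X_m (and ι_{nn} = id). -/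
/-- The orbit `x 0 = x₀`, `x (n+1) = T n (x n)` of an iteration between the fibres of a
family of spaces. -/
def iterOrbit {X : ℕ → Type*} (T : ∀ n, X n → X (n + 1)) (x₀ : X 0) : ∀ n, X n
  | 0 => x₀
  | n + 1 => T n (iterOrbit T x₀ n)

/-- relative Banach contraction theorem.  Let `(X n, d n)` be metric
spaces, `ι n : X n → X (n+1)` nonexpansive maps, `ιc` the composite restriction maps
(`ιc (le_refl n) = id`, `ιc (n ≤ m+1) = ι m ∘ ιc (n ≤ m)`), and `T n : X n → X (n+1)`
maps commuting with the restrictions such that `T n` is a contraction with factor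
`lam (n+1)`, where the positive factors `lam 1 ≥ lam 2 ≥ ⋯` satisfy
`lam 1 ⋯ lam n → 0`.  Then for any `x₀ ∈ X 0` the orbit `x (n+1) = T n (x n)` is Cauchy
in the relative sense. -/
theorem relative_contraction_cauchy {X : ℕ → Type*} [∀ n, MetricSpace (X n)]
    (ι : ∀ n, X n → X (n + 1)) (T : ∀ n, X n → X (n + 1)) (lam : ℕ → ℝ)
    (ιc : ∀ {n m : ℕ}, n ≤ m → X n → X m)
    (hιc_refl : ∀ (n : ℕ) (x : X n), ιc (le_refl n) x = x)
    (hιc_succ : ∀ {n m : ℕ} (h : n ≤ m) (x : X n),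
      ιc (h.trans (Nat.le_succ m)) x = ι m (ιc h x))
    (hnonexp : ∀ (n : ℕ) (x y : X n), dist (ι n x) (ι n y) ≤ dist x y)
    (hcomm : ∀ (n : ℕ) (x : X n), ι (n + 1) (T n x) = T (n + 1) (ι n x))
    (hcontr : ∀ (n : ℕ) (x y : X n), dist (T n x) (T n y) ≤ lam (n + 1) * dist x y)
    (hpos : ∀ n : ℕ, 0 < lam (n + 1))
    (hdecr : ∀ n : ℕ, lam (n + 2) ≤ lam (n + 1))
    (hprod : Filter.Tendsto (fun n => ∏ k ∈ Finset.Icc 1 n, lam k)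
      Filter.atTop (nhds 0))
    (x₀ : X 0) :
    ∀ ε > (0 : ℝ), ∃ N : ℕ, ∀ (n m : ℕ) (h : n ≤ m), N ≤ n →
      dist (ιc h (iterOrbit T x₀ n)) (iterOrbit T x₀ m) < ε := by
  obtain ⟨K, hK⟩ : ∃ K, lam (K + 1) < 1 := by
    by_contra hcon
    push Not at hcon
    have h1 : ∀ n, (1 : ℝ) ≤ ∏ k ∈ Finset.Icc 1 n, lam k := by
      intro n
      induction n with
      | zero => simp
      | succ n ih =>
        rw [Finset.prod_Icc_succ_top (by omega)]
        nlinarith [hcon n]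
    have := ge_of_tendsto' hprod h1
    linarith
  have hanti : ∀ n, K ≤ n → lam (n + 1) ≤ lam (K + 1) := by
    intro n hn
    induction n, hn using Nat.le_induction with
    | base => exact le_rfl
    | succ n hn ih => exact (hdecr n).trans ih
  set q := lam (K + 1) with hq
  have hq0 : 0 < q := hpos K
  set x := iterOrbit T x₀ with hx
  have hxs : ∀ n, x (n + 1) = T n (x n) := fun n => rfl
  obtain ⟨e, he⟩ : ∃ e : ℕ → ℝ, ∀ n, e n = dist (ι n (x n)) (x (n + 1)) := ⟨_, fun _ => rfl⟩
  have he0 : ∀ n, 0 ≤ e n := fun n => by rw [he]; exact dist_nonneg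
  have hstep : ∀ n, K ≤ n → e (n + 1) ≤ q * e n := by
    intro n hn
    have h1 : e (n + 1) ≤ lam (n + 2) * e n := by
      rw [he (n + 1), he n, hxs (n + 1)]
      conv_lhs => rw [hxs n, hcomm]
      exact hcontr (n + 1) _ _
    exact h1.trans (mul_le_mul_of_nonneg_right (hanti (n + 1) (by omega)) (he0 n))
  have hgeo : ∀ j, e (K + j) ≤ q ^ j * e K := by
    intro j
    induction j with
    | zero => simp
    | succ j ih =>
      calc e (K + (j + 1)) ≤ q * e (K + j) := hstep (K + j) (by omega)
        _ ≤ q * (q ^ j * e K) := mul_le_mul_of_nonneg_left ih hq0.le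
        _ = q ^ (j + 1) * e K := by ring
  have hsum : ∀ n m (h : n ≤ m), K ≤ n → (1 - q) * dist (ιc h (x n)) (x m) ≤ e n - e m := by
    intro n m h hn
    induction m, h using Nat.le_induction with
    | base => rw [hιc_refl]; simp
    | succ m h ih =>
      have h1 : dist (ιc (h.trans (Nat.le_succ m)) (x n)) (x (m + 1))
          ≤ dist (ιc h (x n)) (x m) + e m := by
        rw [hιc_succ h, he m]
        exact (dist_triangle _ (ι m (x m)) _).trans (add_le_add_left (hnonexp _ _ _) _)
      have h2 := hstep m (by omega)
      have h3 := mul_le_mul_of_nonneg_left h1 (sub_nonneg.2 hK.le)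
      refine h3.trans ?_
      linarith
  intro ε hε
  have hlim : Filter.Tendsto (fun j : ℕ => q ^ j * e K) Filter.atTop (nhds 0) := by
    simpa using (tendsto_pow_atTop_nhds_zero_of_lt_one hq0.le hK).mul_const (e K)
  have hd : 0 < (1 - q) * ε := mul_pos (sub_pos.2 hK) hε
  obtain ⟨J, hJ⟩ := Filter.eventually_atTop.1 (hlim.eventually (gt_mem_nhds hd))
  refine ⟨K + J, fun n m h hn => ?_⟩
  have h1 := hsum n m h (by omega)
  obtain ⟨j, rfl⟩ := Nat.exists_eq_add_of_le (show K ≤ n by omega)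
  have h2 := hJ j (by omega)
  have h3 := hgeo j
  have h4 := he0 m
  exact lt_of_mul_lt_mul_left (by linarith) (sub_pos.2 hK).le
end

section
/- Let f : ℝ → ℝ be twice continuously differentiable on [−1,1], let m, M > 0 and suppose |f'(x)| ≥ 1/m and |f''(x)| ≤ M for all x ∈ [−1,1]. Let y ∈ ℝ and let x, x' ∈ [−1,1] satisfy x' = x − (f(x) − y)/f'(x). Define x'' = x' − (f(x') − y)/f'(x'). Then |x'' − x'| ≤ (mM/2)·(x' − x)². -/
/-- quadratic estimate for one Newton step.  Let `f : ℝ → ℝ` be twice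
continuously differentiable on `[-1,1]` (with derivative `f'` and second derivative `f''`
on this interval, `f''` continuous), let `m, M > 0` with `|f'| ≥ 1/m` and `|f''| ≤ M` on
`[-1,1]`.  If `x, x' ∈ [-1,1]` satisfy `x' = x - (f x - y)/f' x` and
`x'' = x' - (f x' - y)/f' x'`, then `|x'' - x'| ≤ (m M / 2) (x' - x)²`. -/
theorem newton_step_quadratic_estimate
    (f f' f'' : ℝ → ℝ) (m M : ℝ) (hm : 0 < m) (hM : 0 < M)
    (hd1 : ∀ x ∈ Set.Icc (-1 : ℝ) 1, HasDerivWithinAt f (f' x) (Set.Icc (-1 : ℝ) 1) x)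
    (hd2 : ∀ x ∈ Set.Icc (-1 : ℝ) 1, HasDerivWithinAt f' (f'' x) (Set.Icc (-1 : ℝ) 1) x)
    (hcont : ContinuousOn f'' (Set.Icc (-1 : ℝ) 1))
    (hlow : ∀ x ∈ Set.Icc (-1 : ℝ) 1, 1 / m ≤ |f' x|)
    (hupp : ∀ x ∈ Set.Icc (-1 : ℝ) 1, |f'' x| ≤ M)
    (y x x' x'' : ℝ)
    (hx : x ∈ Set.Icc (-1 : ℝ) 1) (hx' : x' ∈ Set.Icc (-1 : ℝ) 1)
    (hstep : x' = x - (f x - y) / f' x)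
    (hstep' : x'' = x' - (f x' - y) / f' x') :
    |x'' - x'| ≤ (m * M / 2) * (x' - x) ^ 2 := by
  have hseg : ∀ t ∈ Set.Icc (0:ℝ) 1, x + t * (x' - x) ∈ Set.Icc (-1 : ℝ) 1 := by
    intro t ht
    obtain ⟨h0, h1⟩ := ht
    obtain ⟨a1, a2⟩ := hx
    obtain ⟨b1, b2⟩ := hx'
    constructor <;> nlinarith
  have hlip : ∀ t ∈ Set.Icc (0:ℝ) 1,
      |f' (x + t * (x' - x)) - f' x| ≤ M * |t * (x' - x)| := by
    intro t ht
    have h := (convex_Icc (-1:ℝ) 1).norm_image_sub_le_of_norm_hasDerivWithin_le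
      (f := f') (f' := f'') (C := M) hd2 (fun z hz => hupp z hz) hx (hseg t ht)
    simpa [Real.norm_eq_abs, abs_mul] using h
  have hg : ∀ t ∈ Set.Icc (0:ℝ) 1,
      HasDerivWithinAt (fun t => f (x + t * (x' - x)) - f x - t * (x' - x) * f' x)
        ((f' (x + t * (x' - x)) - f' x) * (x' - x)) (Set.Icc 0 1) t := by
    intro t ht
    have hl : HasDerivWithinAt (fun t : ℝ => x + t * (x' - x)) (x' - x) (Set.Icc 0 1) t := by
      simpa using (((hasDerivAt_id t).mul_const (x' - x)).const_add x).hasDerivWithinAt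
    have hl2 : HasDerivWithinAt (fun t : ℝ => t * (x' - x) * f' x) ((x' - x) * f' x)
        (Set.Icc 0 1) t := by
      simpa using (((hasDerivAt_id t).mul_const (x' - x)).mul_const (f' x)).hasDerivWithinAt
    have hc := (hd1 _ (hseg t ht)).comp t hl hseg
    have := (hc.sub_const (f x)).sub hl2
    refine this.congr_deriv ?_
    ring
  have htay := image_norm_le_of_norm_deriv_right_le_deriv_boundary
    (f := fun t => f (x + t * (x' - x)) - f x - t * (x' - x) * f' x)
    (f' := fun t => (f' (x + t * (x' - x)) - f' x) * (x' - x))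
    (a := 0) (b := 1) (B := fun t => M * (x' - x) ^ 2 / 2 * t ^ 2)
    (B' := fun t => M * (x' - x) ^ 2 * t)
    (fun t ht => (hg t ht).continuousWithinAt)
    (fun t ht => (hg t ⟨ht.1, ht.2.le⟩).mono_of_mem_nhdsWithin
      (Icc_mem_nhdsGE_of_mem ht))
    (by simp)
    (fun t => by
      refine ((hasDerivAt_pow 2 t).const_mul (M * (x' - x) ^ 2 / 2)).congr_deriv ?_
      simp; ring)
    (fun t ht => by
      have h := hlip t ⟨ht.1, ht.2.le⟩
      rw [Real.norm_eq_abs, abs_mul]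
      rw [abs_mul, abs_of_nonneg ht.1] at h
      have h2 := mul_le_mul_of_nonneg_right h (abs_nonneg (x' - x))
      have h3 := abs_mul_abs_self (x' - x)
      calc _ ≤ _ := h2
        _ = M * t * (|x' - x| * |x' - x|) := by ring
        _ = _ := by rw [h3]; ring)
    (x := 1) (by simp)
  have hpos : ∀ z ∈ Set.Icc (-1 : ℝ) 1, 0 < |f' z| := fun z hz =>
    lt_of_lt_of_le (by positivity) (hlow z hz)
  have hne : f' x ≠ 0 := abs_pos.mp (hpos x hx)
  have hmul : (x' - x) * f' x = y - f x := by
    rw [hstep]; field_simp; ring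
  have hF : |f x' - y| ≤ M * (x' - x) ^ 2 / 2 := by
    simp only [one_mul, Real.norm_eq_abs, hmul, one_pow, mul_one] at htay
    have e : f (x + (x' - x)) - f x - (y - f x) = f x' - y := by
      rw [add_sub_cancel]; ring
    rwa [e] at htay
  have e : x'' - x' = -((f x' - y) / f' x') := by rw [hstep']; ring
  rw [e, abs_neg, abs_div, div_le_iff₀ (hpos x' hx')]
  have h1 : 1 ≤ m * |f' x'| := by
    have := hlow x' hx'
    rwa [div_le_iff₀' hm] at this
  have h2 : 0 ≤ M * (x' - x) ^ 2 / 2 := by positivity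
  nlinarith
end

section
/- Let (a_n)_{n ∈ ℕ} be a strictly increasing sequence of reals with a_n ≥ 1 for all n that satisfies the Bruno condition ∑_{k ≥ 0} |log a_k|/2^{k+1} < ∞ (i.e. a ∈ ℬ⁺). Define the Bruno transform a^π_n := exp(−∑_{k ≥ 0} (log a_{n+k})/2^{k+1}) (the series converges absolutely). Then: (i) a^π_{n+1} = a_n · (a^π_n)² for all n ∈ ℕ; (ii) if (z_n) is defined by z_{n+1} = a_n z_n² with 0 ≤ z_0 < a^π_0 (the Bruno constant of a), then z_n → 0. -/
/-- Let `a` be a strictly increasing sequence with `a n ≥ 1` satisfying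
the Bruno condition `∑ |log (a k)| / 2^(k+1) < ∞`.  Define the Bruno transform
`aπ n = exp (-∑' k, log (a (n+k)) / 2^(k+1))`.  Then (i) `aπ (n+1) = a n * (aπ n)²`, and
(ii) any sequence `z` with `z (n+1) = a n * (z n)²` and `0 ≤ z 0 < aπ 0` tends to `0`. -/
theorem bruno_transform_recursion (a : ℕ → ℝ) (hmono : StrictMono a)
    (h1 : ∀ n, 1 ≤ a n)
    (hBruno : Summable fun k => |Real.log (a k)| / 2 ^ (k + 1)) :
    (∀ n : ℕ,
      Real.exp (-(∑' k : ℕ, Real.log (a (n + 1 + k)) / 2 ^ (k + 1))) =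
        a n * (Real.exp (-(∑' k : ℕ, Real.log (a (n + k)) / 2 ^ (k + 1)))) ^ 2) ∧
    (∀ z : ℕ → ℝ, 0 ≤ z 0 →
      z 0 < Real.exp (-(∑' k : ℕ, Real.log (a k) / 2 ^ (k + 1))) →
      (∀ n, z (n + 1) = a n * (z n) ^ 2) →
      Filter.Tendsto z Filter.atTop (nhds 0)) := by
  have hl : ∀ n, 0 ≤ Real.log (a n) := fun n => Real.log_nonneg (h1 n)
  have hs : ∀ n : ℕ, Summable fun k : ℕ => Real.log (a (n + k)) / 2 ^ (k + 1) := by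
    intro n
    have h := ((summable_nat_add_iff n).2 hBruno).mul_left ((2 : ℝ) ^ n)
    refine h.congr fun k => ?_
    rw [abs_of_nonneg (hl _), add_comm k n]
    field_simp
    ring
  have hi : ∀ n : ℕ,
      Real.exp (-(∑' k : ℕ, Real.log (a (n + 1 + k)) / 2 ^ (k + 1))) =
        a n * (Real.exp (-(∑' k : ℕ, Real.log (a (n + k)) / 2 ^ (k + 1)))) ^ 2 := by
    intro n
    have hpos : 0 < a n := lt_of_lt_of_le one_pos (h1 n)
    have e : ∑' k : ℕ, Real.log (a (n + k)) / 2 ^ (k + 1) =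
        Real.log (a n) / 2 + (∑' k : ℕ, Real.log (a (n + 1 + k)) / 2 ^ (k + 1)) / 2 := by
      rw [(hs n).tsum_eq_zero_add, ← tsum_div_const]
      congr 1
      · simp
      · refine tsum_congr fun k => ?_
        rw [show n + (k + 1) = n + 1 + k by ring, pow_succ 2 (k + 1), div_div]
    rw [e, ← Real.exp_nat_mul]
    nth_rewrite 1 [← Real.exp_log hpos]
    rw [← Real.exp_add]
    congr 1
    push_cast
    ring
  refine ⟨hi, ?_⟩
  intro z hz0 hz hrec
  set P : ℕ → ℝ := fun n => Real.exp (-(∑' k : ℕ, Real.log (a (n + k)) / 2 ^ (k + 1))) with hP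
  have hPpos : ∀ n, 0 < P n := fun n => Real.exp_pos _
  have hP1 : ∀ n, P n ≤ 1 := by
    intro n
    refine Real.exp_le_one_iff.2 (neg_nonpos.2 (tsum_nonneg fun k => ?_))
    exact div_nonneg (hl _) (by positivity)
  have hPr : ∀ n, P (n + 1) = a n * P n ^ 2 := hi
  have hz' : z 0 < P 0 := by simpa [hP] using hz
  have hq0 : 0 ≤ z 0 / P 0 := div_nonneg hz0 (hPpos 0).le
  have hq1 : z 0 / P 0 < 1 := (div_lt_one (hPpos 0)).2 hz'
  generalize hq : z 0 / P 0 = q at hq0 hq1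
  have key : ∀ n, z n = P n * q ^ (2 ^ n) := by
    intro n
    induction n with
    | zero =>
      have := (hPpos 0).ne'
      rw [← hq]
      simp only [pow_zero, pow_one]
      field_simp
    | succ n ih =>
      rw [hrec, hPr, ih, pow_succ 2 n, pow_mul]
      ring
  refine squeeze_zero (g := fun n => q ^ n) (fun n => ?_) (fun n => ?_)
    (tendsto_pow_atTop_nhds_zero_of_lt_one hq0 hq1)
  · rw [key]
    exact mul_nonneg (hPpos n).le (pow_nonneg hq0 _)
  · rw [key]
    calc P n * q ^ (2 ^ n) ≤ 1 * q ^ (2 ^ n) :=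
          mul_le_mul_of_nonneg_right (hP1 n) (pow_nonneg hq0 _)
      _ = q ^ (2 ^ n) := one_mul _
      _ ≤ q ^ n := pow_le_pow_of_le_one hq0 hq1.le Nat.lt_two_pow_self.le
end

section
/- Let (a,b) be a tame pair of sequences of reals: a_n ≥ 1 for all n, 0 < b_n ≤ 1 for all n, b_n → 0, and a_n b_n² ≤ b_{n+1} for all n. Let (x_n) satisfy 0 ≤ x_0 ≤ b_0 and x_{n+1} = (1/2)(a_n x_n² + b_n x_n). Then x_n ≤ b_n for all n, and consequently x_n → 0. -/
/-- Let `(a, b)` be a tame pair: `a n ≥ 1`, `0 < b n ≤ 1`, `b n → 0`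
and `a n * (b n)² ≤ b (n+1)` for all `n`.  If `0 ≤ x 0 ≤ b 0` and
`x (n+1) = (a n * (x n)² + b n * x n) / 2`, then `x n ≤ b n` for all `n`, and `x n → 0`. -/
theorem tame_pair_iteration (a b x : ℕ → ℝ)
    (ha : ∀ n, 1 ≤ a n) (hb0 : ∀ n, 0 < b n) (hb1 : ∀ n, b n ≤ 1)
    (hblim : Filter.Tendsto b Filter.atTop (nhds 0))
    (htame : ∀ n, a n * (b n) ^ 2 ≤ b (n + 1))
    (hx0 : 0 ≤ x 0) (hx0b : x 0 ≤ b 0)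
    (hrec : ∀ n, x (n + 1) = (a n * (x n) ^ 2 + b n * x n) / 2) :
    (∀ n, x n ≤ b n) ∧ Filter.Tendsto x Filter.atTop (nhds 0) := by
  have key : ∀ n, 0 ≤ x n ∧ x n ≤ b n := by
    intro n
    induction n with
    | zero => exact ⟨hx0, hx0b⟩
    | succ k ih =>
      obtain ⟨h0, h1⟩ := ih
      have hak : 0 ≤ a k := le_trans zero_le_one (ha k)
      have hbk : 0 ≤ b k := (hb0 k).le
      rw [hrec k]
      refine ⟨by positivity, ?_⟩
      have e1 : a k * (x k) ^ 2 ≤ a k * (b k) ^ 2 := by gcongr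
      have e2 : b k * x k ≤ b k * b k := by gcongr
      have e3 : 1 * (b k) ^ 2 ≤ a k * (b k) ^ 2 :=
        mul_le_mul_of_nonneg_right (ha k) (sq_nonneg _)
      have e4 := htame k
      nlinarith
  exact ⟨fun n => (key n).2, squeeze_zero (fun n => (key n).1) (fun n => (key n).2) hblim⟩
end

section
/- Let (a,b) be a tame pair of sequences (a_n ≥ 1, 0 < b_n ≤ 1, b_n → 0, a_n b_n² ≤ b_{n+1} for all n) and assume that lim_{n → ∞} (log b_n)/2^n = 0. Then the series ∑_{k ≥ 0} (log a_k)/2^{k+1} converges, i.e. a satisfies the Bruno condition. -/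
/-- Let `(a, b)` be a tame pair (`a n ≥ 1`, `0 < b n ≤ 1`, `b n → 0`,
`a n * (b n)² ≤ b (n+1)`) and assume `log (b n) / 2^n → 0`.  Then the series
`∑ log (a k) / 2^(k+1)` converges, i.e. `a` satisfies the Bruno condition
`∑ |log (a k)| / 2^(k+1) < ∞`. -/
theorem tame_pair_bruno (a b : ℕ → ℝ)
    (ha : ∀ n, 1 ≤ a n) (hb0 : ∀ n, 0 < b n) (hb1 : ∀ n, b n ≤ 1)
    (hblim : Filter.Tendsto b Filter.atTop (nhds 0))
    (htame : ∀ n, a n * (b n) ^ 2 ≤ b (n + 1))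
    (hlog : Filter.Tendsto (fun n => Real.log (b n) / 2 ^ n) Filter.atTop (nhds 0)) :
    Summable (fun k => Real.log (a k) / 2 ^ (k + 1)) ∧
    Summable (fun k => |Real.log (a k)| / 2 ^ (k + 1)) := by
  have hl : ∀ n, 0 ≤ Real.log (a n) := fun n => Real.log_nonneg (ha n)
  have step : ∀ n, Real.log (a n) / 2 ^ (n + 1) ≤
      Real.log (b (n + 1)) / 2 ^ (n + 1) - Real.log (b n) / 2 ^ n := by
    intro n
    have hap : 0 < a n := lt_of_lt_of_le one_pos (ha n)
    have hbp := hb0 n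
    have h := Real.log_le_log (by positivity) (htame n)
    rw [Real.log_mul hap.ne' (by positivity), Real.log_pow] at h
    push_cast at h
    have e : Real.log (b n) / 2 ^ n = (2 * Real.log (b n)) / 2 ^ (n + 1) := by
      rw [pow_succ]
      field_simp
    rw [e, ← sub_div]
    gcongr
    linarith
  have key : ∀ n, ∑ k ∈ Finset.range n, Real.log (a k) / 2 ^ (k + 1) ≤
      Real.log (b n) / 2 ^ n - Real.log (b 0) := by
    intro n
    induction n with
    | zero => simp
    | succ m ih =>
      rw [Finset.sum_range_succ]
      linarith [step m]
  have hs : Summable (fun k => Real.log (a k) / 2 ^ (k + 1)) := by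
    refine summable_of_sum_range_le (c := - Real.log (b 0))
      (fun n => div_nonneg (hl n) (by positivity)) (fun n => ?_)
    have h1 : Real.log (b n) / 2 ^ n ≤ 0 :=
      div_nonpos_of_nonpos_of_nonneg (Real.log_nonpos (hb0 n).le (hb1 n)) (by positivity)
    linarith [key n]
  refine ⟨hs, ?_⟩
  simpa only [abs_of_nonneg (hl _)] using hs
end

section
/- Let d ≥ 1, N ∈ ℕ, and 0 < s ≤ t. Let f be a holomorphic function on the open polydisc D_t = {z ∈ ℂ^d : |z_i| < t for i = 1,…,d} which is square-integrable on D_t (with respect to Lebesgue measure on ℂ^d ≅ ℝ^{2d}), and suppose all derivatives of f at 0 of order < N vanish (so the Taylor series of f at 0 is f(z) = ∑_{|I| ≥ N} a_I z^I). Then ∫_{D_s} |f|² ≤ (s/t)^{2(d+N)} ∫_{D_t} |f|², i.e. ‖f‖_{L²(D_s)} ≤ (s/t)^{d+N} ‖f‖_{L²(D_t)}. -/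
open MeasureTheory
open scoped Pointwise

lemma am_coef (h : ℂ → ℂ) (R : ℝ) (hR : 0 < R) (n : ℤ) :
    fourierCoeffOn (a := 0) (b := 2 * Real.pi) Real.two_pi_pos (fun θ => h (circleMap 0 R θ)) n
      = (R : ℂ) ^ n * ((1 / (2 * Real.pi) : ℝ) * (Complex.I⁻¹ *
        ∮ z in C(0, R), (z - 0)⁻¹ • (z ^ (-n) * h z))) := by
  rw [fourierCoeffOn_eq_integral, circleIntegral, ← intervalIntegral.integral_const_mul,
    ← intervalIntegral.integral_const_mul, ← intervalIntegral.integral_const_mul, sub_zero,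
    Complex.real_smul, ← intervalIntegral.integral_const_mul]
  congr 1
  ext θ
  have hR' : (R : ℂ) ≠ 0 := by exact_mod_cast hR.ne'
  have hc : circleMap 0 R θ ≠ 0 := by simp [circleMap, hR.ne']
  have hpi : (Real.pi : ℂ) ≠ 0 := by exact_mod_cast Real.pi_ne_zero
  rw [fourier_coe_apply, deriv_circleMap]
  simp only [smul_eq_mul, sub_zero]
  have e : Complex.exp (2 * Real.pi * Complex.I * ((-n : ℤ) : ℂ) * θ / ((2 * Real.pi : ℝ) : ℂ))
      = (R : ℂ) ^ n * (circleMap 0 R θ) ^ (-n) := by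
    rw [circleMap, zero_add, mul_zpow, ← mul_assoc, ← zpow_add₀ hR', ← Complex.exp_int_mul]
    simp
    congr 1
    field_simp
  rw [e]
  field_simp

lemma am_memLp (h : ℝ → ℂ) (hc : Continuous h) :
    MemLp h 2 (volume.restrict (Set.Ioc 0 (2 * Real.pi))) := by
  obtain ⟨C, hC⟩ := (isCompact_Icc (a := (0:ℝ)) (b := 2 * Real.pi)).exists_bound_of_continuousOn hc.continuousOn
  refine MemLp.of_bound hc.aestronglyMeasurable C ?_
  refine (ae_restrict_iff' measurableSet_Ioc).2 (Filter.Eventually.of_forall fun x hx => hC x ⟨hx.1.le, hx.2⟩)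

lemma am_mono (h : ℂ → ℂ) (U : Set ℂ) (hU : IsOpen U) (hh : DifferentiableOn ℂ h U)
    (hsub : Metric.closedBall 0 1 ⊆ U) (r : ℝ) (hr : 0 < r) (hr1 : r ≤ 1) :
    ∫ θ in (0:ℝ)..(2 * Real.pi), ‖h (circleMap 0 r θ)‖ ^ 2 ≤
      ∫ θ in (0:ℝ)..(2 * Real.pi), ‖h (circleMap 0 1 θ)‖ ^ 2 := by
  have hcont : ∀ R : ℝ, 0 < R → R ≤ 1 → Continuous (fun θ => h (circleMap 0 R θ)) := by
    intro R h0 h1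
    refine hh.continuousOn.comp_continuous (continuous_circleMap 0 R) fun θ => hsub ?_
    simp [abs_of_pos h0, h1]
  have S1 := hasSum_sq_fourierCoeffOn Real.two_pi_pos (am_memLp _ (hcont r hr hr1))
  have S2 := hasSum_sq_fourierCoeffOn Real.two_pi_pos (am_memLp _ (hcont 1 one_pos le_rfl))
  have hdiff : ∀ z ∈ Metric.closedBall (0:ℂ) 1, DifferentiableAt ℂ h z := fun z hz =>
    hh.differentiableAt (hU.mem_nhds (hsub hz))
  have key := hasSum_le (fun n : ℤ => ?_) S1 S2
  · simp only [smul_eq_mul] at key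
    exact le_of_mul_le_mul_left key (by rw [sub_zero]; exact inv_pos.2 Real.two_pi_pos)
  · refine pow_le_pow_left₀ (norm_nonneg _) ?_ 2
    rw [am_coef h r hr n, am_coef h 1 one_pos n]
    have hJ : ∮ z in C(0, 1), (z - 0)⁻¹ • (z ^ (-n) * h z) = ∮ z in C(0, r), (z - 0)⁻¹ • (z ^ (-n) * h z) := by
      have hd : ∀ z ∈ Metric.closedBall (0:ℂ) 1 \ Metric.ball 0 r, DifferentiableAt ℂ (fun z => z ^ (-n) * h z) z := by
        intro z hz
        have hz0 : z ≠ 0 := by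
          rintro rfl
          exact hz.2 (by simpa using hr)
        exact (differentiableAt_zpow.2 (Or.inl hz0)).mul (hdiff z hz.1)
      refine Complex.circleIntegral_sub_center_inv_smul_eq_of_differentiable_on_annulus_off_countable
        hr hr1 Set.countable_empty (fun z hz => (hd z hz).continuousAt.continuousWithinAt) ?_
      intro z hz
      exact hd z ⟨Metric.ball_subset_closedBall hz.1.1, fun h' => hz.1.2 (Metric.ball_subset_closedBall h')⟩
    rcases lt_or_ge n 0 with hn | hn
    · have h0 : ∮ z in C(0, 1), (z - 0)⁻¹ • (z ^ (-n) * h z) = 0 := by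
        obtain ⟨m, rfl⟩ : ∃ m : ℕ, n = -(m + 1 : ℕ) := ⟨(-n - 1).toNat, by omega⟩
        have : ∮ z in C(0, 1), (z - 0)⁻¹ • (z ^ (-(-(m + 1 : ℕ) : ℤ)) * h z) = ∮ z in C(0, 1), z ^ m * h z := by
          refine circleIntegral.integral_congr zero_le_one fun z hz => ?_
          have hz0 : z ≠ 0 := by
            rintro rfl
            simp at hz
          simp only [neg_neg, zpow_natCast, smul_eq_mul, sub_zero, pow_succ]
          field_simp
        rw [this]
        have hd : ∀ z ∈ Metric.closedBall (0:ℂ) 1, DifferentiableAt ℂ (fun z => z ^ m * h z) z :=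
          fun z hz => (differentiableAt_pow m).mul (hdiff z hz)
        exact Complex.circleIntegral_eq_zero_of_differentiable_on_off_countable zero_le_one
          Set.countable_empty (fun z hz => (hd z hz).continuousAt.continuousWithinAt)
          fun z hz => hd z (Metric.ball_subset_closedBall hz.1)
      rw [← hJ, h0]; simp
    · rw [hJ]
      obtain ⟨m, rfl⟩ := Int.eq_ofNat_of_zero_le hn
      rw [norm_mul ((r : ℂ) ^ _), norm_mul (((1 : ℝ) : ℂ) ^ _)]
      refine mul_le_mul_of_nonneg_right ?_ (norm_nonneg _)
      simpa [abs_of_pos hr] using pow_le_one₀ hr.le hr1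

lemma am_slice (N : ℕ) (g : ℂ → ℂ) (U : Set ℂ) (hU : IsOpen U) (hg : DifferentiableOn ℂ g U)
    (hsub : Metric.closedBall 0 1 ⊆ U) (hv : ∀ k < N, iteratedDeriv k g 0 = 0)
    (r : ℝ) (hr : 0 < r) (hr1 : r ≤ 1) :
    ∫ θ in (0:ℝ)..(2 * Real.pi), ‖g (circleMap 0 r θ)‖ ^ 2 ≤
      r ^ (2 * N) * ∫ θ in (0:ℝ)..(2 * Real.pi), ‖g (circleMap 0 1 θ)‖ ^ 2 := by
  have h0U : (0:ℂ) ∈ U := hsub (by simp)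
  have han : AnalyticAt ℂ g 0 := hg.analyticAt (hU.mem_nhds h0U)
  obtain ⟨k, hk, hgk⟩ := (natCast_le_analyticOrderAt han).1
    ((natCast_le_analyticOrderAt_iff_iteratedDeriv_eq_zero han).2 hv)
  simp only [sub_zero, smul_eq_mul] at hgk
  set h : ℂ → ℂ := Function.update (fun z => g z / z ^ N) 0 (k 0) with hh
  have hne : ∀ z, z ≠ 0 → h z = g z / z ^ N := fun z hz => by simp [hh, hz]
  have hhd : DifferentiableOn ℂ h U := by
    intro z hz
    refine DifferentiableAt.differentiableWithinAt ?_
    by_cases hz0 : z = 0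
    · subst hz0
      refine hk.differentiableAt.congr_of_eventuallyEq ?_
      filter_upwards [hgk] with z hz
      by_cases h0 : z = 0
      · subst h0; simp [hh]
      · rw [hne z h0, hz]; field_simp
    · refine ((hg.differentiableAt (hU.mem_nhds hz)).div (differentiableAt_pow N)
        (pow_ne_zero N hz0)).congr_of_eventuallyEq ?_
      filter_upwards [isOpen_ne.mem_nhds hz0] with w hw
      exact hne w hw
  have hnorm : ∀ R : ℝ, 0 < R → ∀ θ, ‖g (circleMap 0 R θ)‖ ^ 2 = R ^ (2 * N) * ‖h (circleMap 0 R θ)‖ ^ 2 := by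
    intro R hR θ
    have hc : circleMap 0 R θ ≠ 0 := by simp [circleMap, hR.ne']
    rw [hne _ hc, norm_div, norm_pow, norm_circleMap_zero, abs_of_pos hR]
    field_simp
    ring
  simp only [hnorm r hr, hnorm 1 one_pos, one_pow, one_mul]
  rw [intervalIntegral.integral_const_mul]
  exact mul_le_mul_of_nonneg_left (am_mono h U hU hhd hsub r hr hr1) (by positivity)

lemma am_dir {d : ℕ} (f : (Fin d → ℂ) → ℂ) (U : Set (Fin d → ℂ)) (hU : IsOpen U)
    (hf : DifferentiableOn ℂ f U) (v : Fin d → ℂ) :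
    DifferentiableOn ℂ (fun z => fderiv ℂ f z v) U := by
  intro x hx
  refine DifferentiableAt.differentiableWithinAt ?_
  have hca : ContinuousAt f x := (hf.differentiableAt (hU.mem_nhds hx)).continuousAt
  have hnb : U ∩ f ⁻¹' (Metric.ball (f x) 1) ∈ nhds x :=
    Filter.inter_mem (hU.mem_nhds hx) (hca (Metric.ball_mem_nhds _ one_pos))
  obtain ⟨ρ, hρ, hball⟩ := Metric.mem_nhds_iff.1 hnb
  have hdiff : ∀ z ∈ Metric.ball x ρ, DifferentiableAt ℂ f z := fun z hz =>
    hf.differentiableAt (hU.mem_nhds (hball hz).1)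
  have hbd : ∀ z ∈ Metric.ball x (ρ / 2), ‖fderiv ℂ f z‖ ≤ 2 / (ρ / 2) := by
    intro z hz
    have hsub : Metric.ball z (ρ / 2) ⊆ Metric.ball x ρ := by
      intro w hw
      rw [Metric.mem_ball] at *
      linarith [dist_triangle w z x]
    refine Complex.norm_fderiv_le_div_of_mapsTo_ball
      (fun w hw => (hdiff w (hsub hw)).differentiableWithinAt) ?_ (by positivity)
    intro w hw
    have h1 := (hball (hsub hw)).2
    have h2 := (hball (hsub (Metric.mem_ball_self (half_pos hρ)))).2
    simp only [Set.mem_preimage, Metric.mem_ball, Metric.mem_closedBall] at *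
    linarith [dist_triangle_right (f w) (f z) (f x)]
  obtain ⟨r, hr, hrv⟩ : ∃ r : ℝ, 0 < r ∧ r * ‖v‖ < ρ / 4 := by
    refine ⟨ρ / 4 / (‖v‖ + 1), by positivity, ?_⟩
    rw [div_mul_eq_mul_div, div_lt_iff₀ (by positivity)]
    nlinarith [norm_nonneg v]
  have hin : ∀ z ∈ Metric.ball x (ρ / 4), ∀ ζ : ℂ, ‖ζ‖ ≤ r → z + ζ • v ∈ Metric.ball x (ρ / 2) := by
    intro z hz ζ hζ
    rw [Metric.mem_ball, dist_eq_norm] at *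
    calc ‖z + ζ • v - x‖ = ‖(z - x) + ζ • v‖ := by congr 1; abel
      _ ≤ ‖z - x‖ + ‖ζ • v‖ := norm_add_le _ _
      _ ≤ ‖z - x‖ + r * ‖v‖ := by rw [norm_smul]; gcongr
      _ < ρ / 2 := by linarith
  have hsmall : Metric.ball x (ρ / 2) ⊆ Metric.ball x ρ := Metric.ball_subset_ball (by linarith)
  -- Cauchy formula
  set a : ℝ → ℂ := fun θ => deriv (circleMap 0 r) θ * (1 / (circleMap 0 r θ - 0) ^ 2) with ha
  have hcm : ∀ θ, circleMap 0 r θ ≠ 0 := fun θ => by simp [circleMap, hr.ne']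
  have hac : Continuous a := by
    have : a = fun θ => circleMap 0 r θ * Complex.I * (1 / (circleMap 0 r θ) ^ 2) := by
      ext θ; simp [ha]
    rw [this]
    have := continuous_circleMap 0 r
    refine (this.mul continuous_const).mul (continuous_const.div (this.pow 2) fun θ => pow_ne_zero 2 (hcm θ))
  have hform : ∀ z ∈ Metric.ball x (ρ / 4), fderiv ℂ f z v = (2 * Real.pi * Complex.I)⁻¹ *
      ∫ θ in Set.Ioc 0 (2 * Real.pi), a θ * f (z + circleMap 0 r θ • v) := by
    intro z hz
    have hline : ∀ ζ : ℂ, HasDerivAt (fun ζ : ℂ => z + ζ • v) v ζ := fun ζ => by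
      simpa using ((hasDerivAt_id ζ).smul_const v).const_add z
    have hD : ∀ ζ ∈ Metric.closedBall (0:ℂ) r, HasDerivAt (fun ζ : ℂ => f (z + ζ • v)) (fderiv ℂ f (z + ζ • v) v) ζ := by
      intro ζ hζ
      exact (hdiff _ (hsmall (hin z hz ζ (by simpa using hζ)))).hasFDerivAt.comp_hasDerivAt ζ (hline ζ)
    have hC := DifferentiableOn.deriv_eq_smul_circleIntegral (c := 0) hr
      (fun ζ hζ => (hD ζ hζ).differentiableAt.differentiableWithinAt)
    have h0 := (hD 0 (by simp [hr.le])).deriv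
    rw [zero_smul, add_zero] at h0
    rw [h0, circleIntegral, intervalIntegral.integral_of_le Real.two_pi_pos.le] at hC
    have : (2 * Real.pi * Complex.I : ℂ) ≠ 0 := Complex.two_pi_I_ne_zero
    rw [eq_inv_mul_iff_mul_eq₀ this, ← smul_eq_mul, ← hC]
    simp only [ha, smul_eq_mul, mul_assoc]
  obtain ⟨C, hC⟩ := (isCompact_Icc (a := (0:ℝ)) (b := 2 * Real.pi)).exists_bound_of_continuousOn hac.continuousOn
  have hcl : ∀ θ, ‖circleMap 0 r θ‖ ≤ r := fun θ => by simp [abs_of_pos hr]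
  have hFc : ∀ z ∈ Metric.ball x (ρ / 4), Continuous (fun θ => a θ * f (z + circleMap 0 r θ • v)) := by
    intro z hz
    refine hac.mul (continuous_iff_continuousAt.2 fun θ => ?_)
    exact ContinuousAt.comp (g := f) (hdiff _ (hsmall (hin z hz _ (hcl θ)))).continuousAt
      (by have := continuous_circleMap 0 r; fun_prop)
  have hmain : HasFDerivAt (fun z => ∫ θ in Set.Ioc 0 (2 * Real.pi), a θ * f (z + circleMap 0 r θ • v))
      (∫ θ in Set.Ioc 0 (2 * Real.pi), a θ • fderiv ℂ f (x + circleMap 0 r θ • v)) x := by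
    refine hasFDerivAt_integral_of_dominated_of_fderiv_le (𝕜 := ℂ)
      (F' := fun z θ => a θ • fderiv ℂ f (z + circleMap 0 r θ • v))
      (bound := fun _ => C * (2 / (ρ / 2))) (Metric.ball_mem_nhds x (ε := ρ / 4) (by positivity)) ?_ ?_ ?_ ?_ ?_ ?_
    · filter_upwards [Metric.ball_mem_nhds x (ε := ρ / 4) (by positivity)] with z hz
      exact (hFc z hz).aestronglyMeasurable
    · exact (hFc x (Metric.mem_ball_self (by positivity))).integrableOn_Ioc
    · refine hac.aestronglyMeasurable.smul ?_
      refine Measurable.aestronglyMeasurable ?_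
      have := continuous_circleMap 0 r
      exact (measurable_fderiv ℂ f).comp (by fun_prop : Continuous fun θ => x + circleMap 0 r θ • v).measurable
    · refine (ae_restrict_iff' measurableSet_Ioc).2 (Filter.Eventually.of_forall fun θ hθ z hz => ?_)
      rw [norm_smul]
      have h1 := hC θ ⟨hθ.1.le, hθ.2⟩
      exact mul_le_mul h1 (hbd _ (hin z hz _ (hcl θ))) (norm_nonneg _) ((norm_nonneg _).trans h1)
    · exact integrable_const _
    · refine Filter.Eventually.of_forall fun θ z hz => ?_
      have h1 := (hdiff _ (hsmall (hin z hz _ (hcl θ)))).hasFDerivAt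
      have h2 := h1.comp z ((hasFDerivAt_id z).add_const (circleMap 0 r θ • v))
      simpa using h2.const_mul (a θ)
  refine (hmain.differentiableAt.const_mul (2 * Real.pi * Complex.I)⁻¹).congr_of_eventuallyEq ?_
  filter_upwards [Metric.ball_mem_nhds x (ε := ρ / 4) (by positivity)] with z hz
  exact hform z hz

lemma am_contDiff {d : ℕ} (U : Set (Fin d → ℂ)) (hU : IsOpen U) (n : ℕ) :
    ∀ f : (Fin d → ℂ) → ℂ, DifferentiableOn ℂ f U → ContDiffOn ℂ n f U := by
  induction n with
  | zero => intro f hf; simpa using hf.continuousOn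
  | succ n ih =>
    intro f hf
    have : ((n + 1 : ℕ) : WithTop ℕ∞) = (n : WithTop ℕ∞) + 1 := by norm_cast
    rw [this, contDiffOn_succ_iff_fderiv_of_isOpen hU]
    refine ⟨hf, fun h => by simp at h, ?_⟩
    rw [contDiffOn_clm_apply]
    exact fun v => ih _ (am_dir f U hU hf v)

lemma am_line {d : ℕ} (f : (Fin d → ℂ) → ℂ) (U : Set (Fin d → ℂ)) (hU : IsOpen U) (h0 : 0 ∈ U)
    (hf : DifferentiableOn ℂ f U) (N : ℕ) (hv : ∀ n < N, iteratedFDeriv ℂ n f 0 = 0)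
    (w : Fin d → ℂ) (k : ℕ) (hk : k < N) :
    iteratedDeriv k (fun ζ : ℂ => f (ζ • w)) 0 = 0 := by
  let L : ℂ →L[ℂ] (Fin d → ℂ) := (ContinuousLinearMap.id ℂ ℂ).smulRight w
  have hL : (fun ζ : ℂ => f (ζ • w)) = f ∘ L := by ext; simp [L]
  have hUL : IsOpen (L ⁻¹' U) := hU.preimage L.continuous
  have hL0 : L 0 ∈ U := by simpa using h0
  have h := L.iteratedFDerivWithin_comp_right (am_contDiff U hU k f hf) hU.uniqueDiffOn
    hUL.uniqueDiffOn (x := 0) hL0 (i := k) le_rfl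
  rw [iteratedFDerivWithin_of_isOpen k hUL hL0, iteratedFDerivWithin_of_isOpen k hU hL0, map_zero,
    hv k hk] at h
  rw [hL, iteratedDeriv_eq_iteratedFDeriv, h]
  simp

lemma am_rot {d : ℕ} (t : ℝ) (θ : ℝ) (G : (Fin d → ℂ) → ENNReal) :
    ∫⁻ w in {z : Fin d → ℂ | ∀ i, ‖z i‖ < t}, G (circleMap 0 1 θ • w) =
      ∫⁻ w in {z : Fin d → ℂ | ∀ i, ‖z i‖ < t}, G w := by
  have hc : ‖circleMap 0 1 θ‖ = 1 := by simp
  have hc0 : circleMap 0 1 θ ≠ 0 := by rw [← norm_pos_iff, hc]; exact one_pos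
  have hmp : MeasurePreserving (fun w : Fin d → ℂ => circleMap 0 1 θ • w) volume volume := by
    have h := volume_preserving_pi (ι := Fin d) (f := fun _ => rotation (Circle.exp θ))
      (fun i => LinearIsometryEquiv.measurePreserving _)
    have e : (fun w : Fin d → ℂ => circleMap 0 1 θ • w) =
        fun a i => (rotation (Circle.exp θ)) (a i) := by
      funext w i
      simp [rotation_apply, circleMap]
    rw [e]
    exact h
  have hemb : MeasurableEmbedding (fun w : Fin d → ℂ => circleMap 0 1 θ • w) :=
    (Homeomorph.smulOfNeZero _ hc0).measurableEmbedding
  have hpre : (fun w : Fin d → ℂ => circleMap 0 1 θ • w) ⁻¹' {z : Fin d → ℂ | ∀ i, ‖z i‖ < t} =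
      {z : Fin d → ℂ | ∀ i, ‖z i‖ < t} := by
    ext w; simp
  have := hmp.setLIntegral_comp_preimage_emb hemb G {z : Fin d → ℂ | ∀ i, ‖z i‖ < t}
  rwa [hpre] at this

lemma am_open {d : ℕ} (t : ℝ) : IsOpen {z : Fin d → ℂ | ∀ i, ‖z i‖ < t} := by
  simp only [Set.ofPred_forall]
  exact isOpen_iInter_of_finite fun i => isOpen_lt (by fun_prop) continuous_const

lemma am_key {d : ℕ} (N : ℕ) (t r : ℝ) (ht : 0 < t) (hr : 0 < r) (hr1 : r ≤ 1)
    (f : (Fin d → ℂ) → ℂ)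
    (hf : DifferentiableOn ℂ f {z : Fin d → ℂ | ∀ i, ‖z i‖ < t})
    (hvanish : ∀ n < N, iteratedFDeriv ℂ n f 0 = 0) :
    ∫⁻ w in {z : Fin d → ℂ | ∀ i, ‖z i‖ < t}, ENNReal.ofReal (‖f (r • w)‖ ^ 2) ≤
      ENNReal.ofReal (r ^ (2 * N)) *
        ∫⁻ w in {z : Fin d → ℂ | ∀ i, ‖z i‖ < t}, ENNReal.ofReal (‖f w‖ ^ 2) := by
  set D := {z : Fin d → ℂ | ∀ i, ‖z i‖ < t} with hD
  have hDo : IsOpen D := am_open t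
  have hDm : MeasurableSet D := hDo.measurableSet
  have hDs : ∀ ζ : ℂ, ‖ζ‖ ≤ 1 → ∀ w ∈ D, ζ • w ∈ D := by
    intro ζ hζ w hw i
    have := hw i
    simp only [Pi.smul_apply, smul_eq_mul, norm_mul]
    nlinarith [norm_nonneg (w i)]
  set G : (Fin d → ℂ) → ENNReal := D.indicator (fun z => ENNReal.ofReal (‖f z‖ ^ 2)) with hG
  have hGm : Measurable G := by
    have h1 : Measurable (D.indicator f) := by
      refine measurable_of_restrict_of_restrict_compl hDm ?_ ?_
      · have e : D.domRestrict (D.indicator f) = D.domRestrict f := by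
          ext ⟨x, hx⟩; simp [hx]
        rw [e]; exact (continuousOn_iff_continuous_restrict.1 hf.continuousOn).measurable
      · have e : Dᶜ.domRestrict (D.indicator f) = fun _ => 0 := by
          ext ⟨x, hx⟩; exact Set.indicator_of_notMem hx f
        rw [e]; exact measurable_const
    have : G = fun z => ENNReal.ofReal (‖D.indicator f z‖ ^ 2) := by
      ext z
      by_cases hz : z ∈ D <;> simp [hG, hz]
    rw [this]
    exact ((h1.norm).pow_const 2).ennreal_ofReal
  have hGD : ∀ z ∈ D, G z = ENNReal.ofReal (‖f z‖ ^ 2) := fun z hz => by simp [hG, hz]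
  have hcn : ∀ R : ℝ, 0 < R → R ≤ 1 → ∀ θ, ‖circleMap 0 R θ‖ ≤ 1 := fun R h0 h1 θ => by
    simpa [abs_of_pos h0] using h1
  -- averaging
  have havg : ∀ R : ℝ, 0 < R → R ≤ 1 →
      ENNReal.ofReal (2 * Real.pi) * ∫⁻ w in D, ENNReal.ofReal (‖f (R • w)‖ ^ 2) =
      ∫⁻ w in D, ENNReal.ofReal (∫ θ in (0:ℝ)..(2 * Real.pi), ‖f (circleMap 0 R θ • w)‖ ^ 2) := by
    intro R h0 h1
    have e1 : ∀ θ : ℝ, ∫⁻ w in D, ENNReal.ofReal (‖f (R • w)‖ ^ 2) =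
        ∫⁻ w in D, G (circleMap 0 R θ • w) := by
      intro θ
      have hc : ∀ w : Fin d → ℂ, circleMap 0 R θ • w = (R : ℂ) • (circleMap 0 1 θ • w) := by
        intro w; rw [smul_smul]; congr 1; simp [circleMap]
      simp only [hc]
      rw [am_rot t θ (fun w => G ((R : ℂ) • w))]
      refine setLIntegral_congr_fun hDm fun w hw => ?_
      have : (R : ℂ) • w = R • w := by ext i; simp
      simp only [this]
      rw [hGD]
      rw [← this]
      exact hDs _ (by simpa [abs_of_pos h0] using h1) w hw
    have e2 : ENNReal.ofReal (2 * Real.pi) * ∫⁻ w in D, ENNReal.ofReal (‖f (R • w)‖ ^ 2) =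
        ∫⁻ θ in Set.Ioc 0 (2 * Real.pi), ∫⁻ w in D, G (circleMap 0 R θ • w) := by
      rw [← lintegral_congr (fun θ => e1 θ), setLIntegral_const, Real.volume_Ioc, sub_zero, mul_comm]
    rw [e2, lintegral_lintegral_swap]
    · refine setLIntegral_congr_fun hDm fun w hw => ?_
      have hin : ∀ θ, circleMap 0 R θ • w ∈ D := fun θ => hDs _ (hcn R h0 h1 θ) w hw
      have hcont : Continuous fun θ => ‖f (circleMap 0 R θ • w)‖ ^ 2 := by
        refine (Continuous.norm ?_).pow 2
        refine hf.continuousOn.comp_continuous ?_ hin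
        have := continuous_circleMap 0 R
        fun_prop
      simp only [hGD _ (hin _)]
      rw [intervalIntegral.integral_of_le Real.two_pi_pos.le,
        ofReal_integral_eq_lintegral_ofReal hcont.integrableOn_Ioc
          (Filter.Eventually.of_forall fun θ => by positivity)]
    · refine Measurable.aemeasurable ?_
      refine hGm.comp (Continuous.measurable ?_)
      have := continuous_circleMap 0 R
      exact (this.comp continuous_fst).smul continuous_snd
  have hfin : ENNReal.ofReal (2 * Real.pi) * ∫⁻ w in D, ENNReal.ofReal (‖f (r • w)‖ ^ 2) ≤
      ENNReal.ofReal (2 * Real.pi) * (ENNReal.ofReal (r ^ (2 * N)) *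
        ∫⁻ w in D, ENNReal.ofReal (‖f w‖ ^ 2)) := by
    have h1 := havg 1 one_pos le_rfl
    simp only [one_smul] at h1
    rw [mul_left_comm, h1, havg r hr hr1, ← lintegral_const_mul' _ _ ENNReal.ofReal_ne_top]
    refine setLIntegral_mono' hDm fun w hw => ?_
    rw [← ENNReal.ofReal_mul (by positivity)]
    refine ENNReal.ofReal_le_ofReal ?_
    have hU : IsOpen ((fun ζ : ℂ => ζ • w) ⁻¹' D) := hDo.preimage (by fun_prop)
    refine am_slice N (fun ζ => f (ζ • w)) _ hU ?_ ?_ ?_ r hr hr1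
    · exact hf.comp (by fun_prop) (Set.mapsTo_preimage _ _)
    · intro ζ hζ
      exact hDs ζ (by simpa using hζ) w hw
    · exact fun k hk => am_line f D hDo (fun i => by simpa using ht) hf N hvanish w k hk
  have hp : ENNReal.ofReal (2 * Real.pi) ≠ 0 := by
    simpa using Real.pi_pos
  exact (ENNReal.mul_le_mul_iff_right hp ENNReal.ofReal_ne_top).1 hfin

/-- Arnold–Moser cut-off lemma.  Let `d ≥ 1`, `N ∈ ℕ`, `0 < s ≤ t`,
and let `f` be holomorphic on the open polydisc `D t = {z : Fin d → ℂ | ∀ i, ‖z i‖ < t}`,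
square-integrable on `D t`, with all derivatives of order `< N` vanishing at `0`.
Then `∫_{D s} ‖f‖² ≤ (s/t)^(2(d+N)) ∫_{D t} ‖f‖²`. -/
theorem arnold_moser_cutoff (d : ℕ) (hd : 1 ≤ d) (N : ℕ) (s t : ℝ)
    (hs : 0 < s) (hst : s ≤ t) (f : (Fin d → ℂ) → ℂ)
    (hf : DifferentiableOn ℂ f {z : Fin d → ℂ | ∀ i, ‖z i‖ < t})
    (hint : IntegrableOn (fun z => ‖f z‖ ^ 2) {z : Fin d → ℂ | ∀ i, ‖z i‖ < t} volume)
    (hvanish : ∀ n < N, iteratedFDeriv ℂ n f 0 = 0) :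
    ∫ z in {z : Fin d → ℂ | ∀ i, ‖z i‖ < s}, ‖f z‖ ^ 2 ≤
      (s / t) ^ (2 * (d + N)) * ∫ z in {z : Fin d → ℂ | ∀ i, ‖z i‖ < t}, ‖f z‖ ^ 2 := by
  have ht : 0 < t := hs.trans_le hst
  have hr : 0 < s / t := div_pos hs ht
  have hr1 : s / t ≤ 1 := (div_le_one ht).2 hst
  have key := am_key N t (s / t) ht hr hr1 f hf hvanish
  have hset : (s / t) • {z : Fin d → ℂ | ∀ i, ‖z i‖ < t} = {z : Fin d → ℂ | ∀ i, ‖z i‖ < s} := by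
    ext z
    rw [Set.mem_smul_set_iff_inv_smul_mem₀ hr.ne']
    simp only [Set.mem_ofPred_eq, Pi.smul_apply, norm_smul, norm_inv, Real.norm_of_nonneg hr.le]
    refine forall_congr' fun i => ?_
    rw [inv_mul_lt_iff₀ hr, div_mul_cancel₀ _ ht.ne']
  have hcv := Measure.setIntegral_comp_smul_of_pos (volume : Measure (Fin d → ℂ))
    (fun z => ‖f z‖ ^ 2) {z : Fin d → ℂ | ∀ i, ‖z i‖ < t} hr
  have hfr : Module.finrank ℝ (Fin d → ℂ) = 2 * d := by
    rw [Module.finrank_pi_fintype]; simp [Complex.finrank_real_complex, mul_comm]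
  rw [hset, hfr, smul_eq_mul, eq_inv_mul_iff_mul_eq₀ (by positivity)] at hcv
  rw [← hcv, mul_add, pow_add, mul_assoc]
  refine mul_le_mul_of_nonneg_left ?_ (by positivity)
  rw [← ofReal_integral_eq_lintegral_ofReal hint (Filter.Eventually.of_forall fun _ => by positivity),
    ← ENNReal.ofReal_mul (by positivity)] at key
  have hnn : 0 ≤ (s / t) ^ (2 * N) * ∫ z in {z : Fin d → ℂ | ∀ i, ‖z i‖ < t}, ‖f z‖ ^ 2 :=
    mul_nonneg (by positivity) (integral_nonneg fun _ => by positivity)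
  by_cases hI : IntegrableOn (fun w => ‖f ((s / t) • w)‖ ^ 2) {z : Fin d → ℂ | ∀ i, ‖z i‖ < t} volume
  · rw [← ofReal_integral_eq_lintegral_ofReal hI (Filter.Eventually.of_forall fun _ => by positivity)] at key
    exact (ENNReal.ofReal_le_ofReal_iff hnn).1 key
  · rw [integral_undef hI]
    exact hnn
end

section
/- There exists ε > 0 with the following property: for every function r : ℂ → ℂ continuous on the closed unit disc {z : |z| ≤ 1}, complex-differentiable on the open unit disc, with r(0) = r'(0) = r''(0) = 0 and sup_{|z| ≤ 1} |r(z)| ≤ ε, there exist s ∈ (0,1) and an injective holomorphic map φ on the open disc {z : |z| < s} with φ(0) = 0 and φ({|z| < s}) contained in the open unit disc, such that φ(z)² + r(φ(z)) = z² for all |z| < s. -/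
/-- one-dimensional complex Morse lemma.  There exists `ε > 0` such
that for every `r : ℂ → ℂ` continuous on the closed unit disc, holomorphic on the open
unit disc, with `r 0 = r' 0 = r'' 0 = 0` and `sup_{‖z‖ ≤ 1} ‖r z‖ ≤ ε`, there exist
`s ∈ (0,1)` and an injective holomorphic map `φ` on the disc of radius `s` with
`φ 0 = 0`, mapping into the open unit disc, such that `(φ z)² + r (φ z) = z²` on the
disc of radius `s`. -/
theorem complex_morse_lemma :
    ∃ ε > (0 : ℝ), ∀ r : ℂ → ℂ,
      ContinuousOn r (Metric.closedBall 0 1) →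
      DifferentiableOn ℂ r (Metric.ball 0 1) →
      r 0 = 0 → deriv r 0 = 0 → deriv (deriv r) 0 = 0 →
      (∀ z ∈ Metric.closedBall (0 : ℂ) 1, ‖r z‖ ≤ ε) →
      ∃ s ∈ Set.Ioo (0 : ℝ) 1, ∃ φ : ℂ → ℂ,
        DifferentiableOn ℂ φ (Metric.ball 0 s) ∧
        Set.InjOn φ (Metric.ball 0 s) ∧
        φ 0 = 0 ∧
        Set.MapsTo φ (Metric.ball 0 s) (Metric.ball 0 1) ∧
        ∀ z ∈ Metric.ball (0 : ℂ) s, (φ z) ^ 2 + r (φ z) = z ^ 2 := by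
  refine ⟨1, one_pos, fun r _ hd h0 h1 h2 _ => ?_⟩
  have hr : AnalyticAt ℂ r 0 := hd.analyticAt (Metric.ball_mem_nhds 0 one_pos)
  obtain ⟨g, hg, hrg⟩ := (natCast_le_analyticOrderAt (n := 3) hr).1
    ((natCast_le_analyticOrderAt_iff_iteratedDeriv_eq_zero hr).2 (by
      intro i hi
      interval_cases i
      · simpa using h0
      · simpa [iteratedDeriv_one] using h1
      · simpa [iteratedDeriv_succ, iteratedDeriv_one] using h2))
  have hh : AnalyticAt ℂ (fun z => (1 + z * g z) ^ (((2 : ℕ) : ℂ)⁻¹)) 0 := by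
    refine AnalyticAt.cpow (by fun_prop) (by fun_prop) ?_
    simp
  obtain ⟨ψ, hψ⟩ : ∃ ψ : ℂ → ℂ, ψ = fun z => z * (1 + z * g z) ^ (((2 : ℕ) : ℂ)⁻¹) := ⟨_, rfl⟩
  have hψa : AnalyticAt ℂ ψ 0 := by rw [hψ]; exact analyticAt_id.mul hh
  have hψ0 : ψ 0 = 0 := by simp [hψ]
  have hψd : HasDerivAt ψ 1 0 := by
    have := (hasDerivAt_id (0 : ℂ)).mul hh.differentiableAt.hasDerivAt
    rw [hψ]
    convert! this using 1
    simp
  have hsq : ∀ᶠ z in nhds (0 : ℂ), ψ z ^ 2 = z ^ 2 + r z := by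
    filter_upwards [hrg] with z hz
    rw [hz, hψ]
    simp only [mul_pow, Complex.cpow_nat_inv_pow _ two_ne_zero, sub_zero, smul_eq_mul]
    ring
  have hc : ContDiffAt ℂ 1 ψ 0 := hψa.contDiffAt
  have hf' : HasFDerivAt ψ
      ((ContinuousLinearEquiv.unitsEquivAut ℂ (Units.mk0 1 one_ne_zero) : ℂ ≃L[ℂ] ℂ) : ℂ →L[ℂ] ℂ) 0 :=
    hψd.hasFDerivAt_equiv one_ne_zero
  have hφc := hc.to_localInverse hf' one_ne_zero
  have hφ0 := hc.localInverse_apply_image hf' one_ne_zero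
  have hri : ∀ᶠ y in nhds (ψ 0), ψ (hc.localInverse hf' one_ne_zero y) = y :=
    (hc.hasStrictFDerivAt' hf' one_ne_zero).eventually_right_inverse
  generalize hc.localInverse hf' one_ne_zero = φ at hφc hφ0 hri
  rw [hψ0] at hφc hφ0 hri
  have ht : Filter.Tendsto φ (nhds 0) (nhds 0) := by
    have := hφc.continuousAt.tendsto
    rwa [hφ0] at this
  have hdiff : ∀ᶠ z in nhds (0 : ℂ), DifferentiableAt ℂ φ z :=
    (hφc.eventually (by simp)).mono fun z hz => hz.differentiableAt one_ne_zero
  obtain ⟨δ, hδ, H⟩ := Metric.eventually_nhds_iff_ball.1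
    (hri.and (hdiff.and ((ht.eventually hsq).and
      (ht.eventually (Metric.ball_mem_nhds (0 : ℂ) one_pos)))))
  have hs : Metric.ball (0 : ℂ) (min δ (1 / 2)) ⊆ Metric.ball 0 δ :=
    Metric.ball_subset_ball (min_le_left _ _)
  refine ⟨min δ (1 / 2), ⟨by positivity, (min_le_right _ _).trans_lt (by norm_num)⟩, φ,
    fun z hz => (H z (hs hz)).2.1.differentiableWithinAt, ?_, hφ0,
    fun z hz => (H z (hs hz)).2.2.2, fun z hz => ?_⟩
  · intro x hx y hy hxy
    rw [← (H x (hs hx)).1, ← (H y (hs hy)).1, hxy]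
  · rw [← (H z (hs hz)).2.2.1, (H z (hs hz)).1]
end
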